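/- Let f(x) ∈ R_m and let C be a one-generator quasi-cyclic code over F_q which, under the identification of F_q^{lm} with R_m^l, is the [l,1] linear code over R_m ε_t given by C = {(g(x)a_0(x), …, g(x)a_{l−1}(x)) : g(x) ∈ R_m ε_t}, where each a_v(x) ∈ {0, f(x)} for 0 ≤ v ≤ l−1 and C is of dimension 1 over R_m ε_t. Suppose the primitive idempotent ε_t corresponds to the q-cyclotomic coset {i_t, i_t q, …, i_t q^{k−1}} modulo m. Then the number of orbits of ⟨μ_q, ρ^l, M⟩ on C* = C \ {0} is equal to (1/k)·Σ_{r | k} φ(k/r)·gcd(q^r − 1, (q^k − 1)/(q−1), i_t(q^k − 1)/m). In particular, s(C) is at most this quantity, with equality if and only if for any two nonzero codewords c₁, c₂ ∈ C* with the same Hamming weight there exist integers i, j and a ∈ F_q^* such that μ_q^i ρ^{jl} σ_a(c₁) = c₂. -/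

import Mathlib

/-- The shift `ρ^l` on `F^{lm}`, with a codeword indexed as `c (i, j) = c_{ij}`
(`i ∈ ZMod m` the block index, `j ∈ Fin l` the position inside a block):
`(ρ^l c) (i, j) = c (i - 1, j)`. -/
noncomputable def shiftQC (F : Type*) [Field F] (m l : ℕ) :
    ((ZMod m × Fin l) → F) ≃ₗ[F] ((ZMod m × Fin l) → F) :=
  LinearEquiv.funCongrLeft F F ((Equiv.subRight (1 : ZMod m)).prodCongr (Equiv.refl (Fin l)))

/-- The multiplier `μ_q` on `F^{lm}` determined by the unit `u = q` of `ZMod m`: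
under the identification with `R_m^l` it sends `Σ c_i x^i ↦ Σ c_i x^{q i}` in every
component, i.e. `(μ_q c) (i, j) = c (q⁻¹ i, j)`. -/
noncomputable def multiplierQC (F : Type*) [Field F] (m l : ℕ) (u : (ZMod m)ˣ) :
    ((ZMod m × Fin l) → F) ≃ₗ[F] ((ZMod m × Fin l) → F) :=
  LinearEquiv.funCongrLeft F F ((MulAction.toPerm u⁻¹).prodCongr (Equiv.refl (Fin l)))

/-- The `q`-cyclotomic coset of `i_t` modulo `m`, viewed inside `ZMod m`. -/
def cycCoset (q m it : ℕ) : Set (ZMod m) :=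
  {j | ∃ r : ℕ, j = (it : ZMod m) * (q : ZMod m) ^ r}

/-- Evaluation of the polynomial `Σ_i c_i x^i ∈ R_m = F[x]/(x^m - 1)` at `ζ^j`, computed in
an extension field `E` of `F` containing the primitive `m`-th root of unity `ζ`. -/
noncomputable def evalDFT {F E : Type*} [Field F] [Field E] [Algebra F E] {m : ℕ} [NeZero m]
    (ζ : E) (c : ZMod m → F) (j : ZMod m) : E :=
  ∑ i : ZMod m, algebraMap F E (c i) * ζ ^ (i * j).val

/-- `Σ_i c_i x^i` lies in the minimal ideal `R_m ε_t` of `R_m` associated with the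
`q`-cyclotomic coset of `i_t`, i.e. it vanishes at `ζ^j` for every `j` outside the coset. -/
def inMinIdeal {F E : Type*} [Field F] [Field E] [Algebra F E] (q : ℕ) {m : ℕ} [NeZero m]
    (ζ : E) (it : ℕ) (c : ZMod m → F) : Prop :=
  ∀ j : ZMod m, j ∉ cycCoset q m it → evalDFT ζ c j = 0

/-- Multiplication (cyclic convolution) in `R_m = F[x]/(x^m - 1)`, on coefficient vectors. -/
noncomputable def cconv {F : Type*} [Field F] {m : ℕ} [NeZero m] (g h : ZMod m → F) :
    ZMod m → F := fun i => ∑ i' : ZMod m, g i' * h (i - i')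

section OrbitCount

/-- The powers of an element `w` with `w ^ k = 1` acting by multiplication. -/
abbrev powMulAction {R : Type*} [CommRing R] {k : ℕ} [NeZero k] (w : R) (hw : w ^ k = 1) :
    MulAction (Multiplicative (ZMod k)) R where
  smul s x := w ^ s.toAdd.val * x
  one_smul x := by
    change w ^ (0 : ZMod k).val * x = x
    simp
  mul_smul s t x := by
    change w ^ (s.toAdd + t.toAdd).val * x = w ^ s.toAdd.val * (w ^ t.toAdd.val * x)
    rw [← mul_assoc, ← pow_add, ZMod.val_add, ← pow_eq_pow_mod _ hw]

theorem card_mul_eq_self_zmod (G q s : ℕ) [NeZero G] (hq : 0 < q) :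
    Nat.card {x : ZMod G // (q : ZMod G) ^ s * x = x} = Nat.gcd (q ^ s - 1) G := by
  rw [Nat.gcd_comm]
  conv_rhs => rw [← Nat.card_zmod G]
  rw [← IsAddCyclic.card_nsmulAddMonoidHom_ker]
  refine Nat.card_congr (Equiv.subtypeEquivRight fun x => ?_)
  have h1 : 1 ≤ q ^ s := Nat.one_le_pow _ _ hq
  rw [AddMonoidHom.mem_ker, nsmulAddMonoidHom_apply, nsmul_eq_mul, Nat.cast_sub h1]
  push_cast
  rw [sub_mul, one_mul, sub_eq_zero]

theorem gcd_pow_sub_one_eq {q k G : ℕ} (hG : G ∣ q ^ k - 1) (s : ℕ) :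
    Nat.gcd (q ^ s - 1) G = Nat.gcd (q ^ (k.gcd s) - 1) G := by
  conv_lhs => rw [← Nat.gcd_eq_right hG]
  rw [← Nat.gcd_assoc, Nat.pow_sub_one_gcd_pow_sub_one, Nat.gcd_comm s k]

theorem sum_gcd_pow_sub_one {q k G : ℕ} (hk : 0 < k) (hG : G ∣ q ^ k - 1) :
    ∑ s ∈ Finset.range k, Nat.gcd (q ^ s - 1) G =
      ∑ r ∈ k.divisors, Nat.totient (k / r) * Nat.gcd (q ^ r - 1) G := by
  rw [← Finset.sum_fiberwise_of_maps_to (g := fun s => k.gcd s) (t := k.divisors)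
    (fun s _ => Nat.mem_divisors.2 ⟨Nat.gcd_dvd_left _ _, hk.ne'⟩)]
  refine Finset.sum_congr rfl fun r hr => ?_
  rw [Nat.totient_div_of_dvd (Nat.dvd_of_mem_divisors hr), ← smul_eq_mul, ← Finset.sum_const]
  refine Finset.sum_congr rfl fun s hs => ?_
  rw [gcd_pow_sub_one_eq hG, (Finset.mem_filter.1 hs).2]

/-- Burnside's lemma for multiplication by `q` on `ZMod G` when `G ∣ q ^ k - 1`. -/
theorem exists_quotient_zmod_mul_pow {q k G : ℕ} [NeZero k] [NeZero G] (hq : 0 < q)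
    (hG : G ∣ q ^ k - 1) :
    ∃ (Q : Type) (_ : Fintype Q) (p : ZMod G → Q), Function.Surjective p ∧
      (∀ x y, p x = p y ↔ ∃ r : ℕ, y = (q : ZMod G) ^ r * x) ∧
      Fintype.card Q * k = ∑ r ∈ k.divisors, Nat.totient (k / r) * Nat.gcd (q ^ r - 1) G := by
  classical
  have hw : (q : ZMod G) ^ k = 1 := by
    have h1 : 1 ≤ q ^ k := Nat.one_le_pow _ _ hq
    have := (ZMod.natCast_eq_zero_iff _ _).2 hG
    rw [Nat.cast_sub h1] at this
    push_cast at this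
    exact sub_eq_zero.1 this
  let := powMulAction (k := k) (q : ZMod G) hw
  have hsmul (s : Multiplicative (ZMod k)) (x : ZMod G) :
      s • x = (q : ZMod G) ^ s.toAdd.val * x := rfl
  refine ⟨Quotient (MulAction.orbitRel (Multiplicative (ZMod k)) (ZMod G)), inferInstance,
    Quotient.mk _, Quotient.mk_surjective, fun x y => ?_, ?_⟩
  · rw [eq_comm, Quotient.eq, MulAction.orbitRel_apply]
    constructor
    · rintro ⟨s, rfl⟩
      exact ⟨_, rfl⟩
    · rintro ⟨r, rfl⟩
      refine ⟨Multiplicative.ofAdd (r : ZMod k), ?_⟩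
      simp only [hsmul, toAdd_ofAdd, ZMod.val_natCast]
      rw [← pow_eq_pow_mod _ hw]
  · have h := MulAction.sum_card_fixedBy_eq_card_orbits_mul_card_group
      (Multiplicative (ZMod k)) (ZMod G)
    rw [Fintype.card_multiplicative, ZMod.card] at h
    rw [← h, ← sum_gcd_pow_sub_one (NeZero.pos k) hG]
    have hfix (s : Multiplicative (ZMod k)) :
        Fintype.card (MulAction.fixedBy (ZMod G) s) = Nat.gcd (q ^ s.toAdd.val - 1) G := by
      rw [← Nat.card_eq_fintype_card, ← card_mul_eq_self_zmod G q _ hq]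
      rfl
    simp only [hfix]
    refine Finset.sum_bij' (fun s _ => s.toAdd.val)
      (fun r _ => Multiplicative.ofAdd (r : ZMod k)) ?_ ?_ ?_ ?_ ?_
    · intro s _
      exact Finset.mem_range.2 (ZMod.val_lt _)
    · simp
    · simp
    · intro r hr
      simpa using Nat.mod_eq_of_lt (Finset.mem_range.1 hr)
    · simp

end OrbitCount

section Fibers

variable {α β γ : Type*} [Nonempty γ] {s : Set α} {f : α → β} {g : α → γ}

theorem exists_image_eq_image_image (h : ∀ x ∈ s, ∀ y ∈ s, f x = f y → g x = g y) :
    ∃ φ : β → γ, (∀ x ∈ s, φ (f x) = g x) ∧ g '' s = φ '' (f '' s) := by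
  have hfac : (g ∘ ((↑) : s → α)).FactorsThrough (f ∘ ((↑) : s → α)) :=
    fun x y hxy => h x x.2 y y.2 hxy
  have hφ : ∀ x ∈ s, Function.extend (f ∘ ((↑) : s → α)) (g ∘ ((↑) : s → α))
      (fun _ => Classical.arbitrary γ) (f x) = g x :=
    fun x hx => hfac.extend_apply _ ⟨x, hx⟩
  refine ⟨_, hφ, ?_⟩
  rw [Set.image_image]
  exact Set.image_congr fun x hx => (hφ x hx).symm

theorem ncard_image_le_ncard_image (hs : s.Finite)
    (h : ∀ x ∈ s, ∀ y ∈ s, f x = f y → g x = g y) : (g '' s).ncard ≤ (f '' s).ncard := by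
  obtain ⟨φ, -, hφ⟩ := exists_image_eq_image_image h
  exact hφ ▸ Set.ncard_image_le (hs.image f)

theorem ncard_image_eq_ncard_image_iff (hs : s.Finite)
    (h : ∀ x ∈ s, ∀ y ∈ s, f x = f y → g x = g y) :
    (g '' s).ncard = (f '' s).ncard ↔ ∀ x ∈ s, ∀ y ∈ s, g x = g y → f x = f y := by
  obtain ⟨φ, hφ, himage⟩ := exists_image_eq_image_image h
  rw [himage, Set.ncard_image_iff (hs.image f)]
  constructor
  · intro hinj x hx y hy hxy
    exact hinj ⟨x, hx, rfl⟩ ⟨y, hy, rfl⟩ (by rw [hφ x hx, hφ y hy, hxy])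
  · rintro hinj _ ⟨x, hx, rfl⟩ _ ⟨y, hy, rfl⟩ hxy
    rw [hφ x hx, hφ y hy] at hxy
    exact hinj x hx y hy hxy

end Fibers

theorem mul_units_mem_cycCoset {q m it : ℕ} (hq : q.Coprime m) {j : ZMod m}
    (h : (q : ZMod m) * j ∈ cycCoset q m it) : j ∈ cycCoset q m it := by
  set u := ZMod.unitOfCoprime q hq
  have hu : ((u : ZMod m)) = q := ZMod.coe_unitOfCoprime q hq
  obtain ⟨r, hr⟩ := h
  obtain ⟨s, hs⟩ : ∃ s, u ^ s = u⁻¹ :=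
    ((isOfFinOrder_of_finite u).mem_powers_iff_mem_zpowers).2 (Subgroup.inv_mem _ (by simp))
  refine ⟨r + s, ?_⟩
  rw [pow_add, ← mul_assoc, ← hr, ← hu, ← Units.val_pow_eq_pow_val, hs, mul_comm]
  simp

section DFT

variable {F E : Type*} [Field F] [Field E] [Algebra F E] {m : ℕ} [NeZero m] {ζ : E}

theorem pow_val_add (hζ : ζ ^ m = 1) (a b : ZMod m) :
    ζ ^ (a + b).val = ζ ^ a.val * ζ ^ b.val := by
  rw [ZMod.val_add, ← pow_eq_pow_mod _ hζ, pow_add]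

theorem evalDFT_shift (hζ : ζ ^ m = 1) (c : ZMod m → F) (j : ZMod m) :
    evalDFT ζ (fun i => c (i - 1)) j = ζ ^ j.val * evalDFT ζ c j := by
  unfold evalDFT
  rw [Finset.mul_sum]
  refine Fintype.sum_equiv (Equiv.subRight 1) _ _ fun i => ?_
  rw [Equiv.subRight_apply, mul_left_comm, ← pow_val_add hζ]
  congr 3
  ring

theorem evalDFT_units_smul (c : ZMod m → F) (u : (ZMod m)ˣ) (j : ZMod m) :
    evalDFT ζ (fun i => c (u⁻¹ • i)) j = evalDFT ζ c (u * j) := by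
  unfold evalDFT
  refine Fintype.sum_equiv (MulAction.toPerm u⁻¹) _ _ fun i => ?_
  rw [MulAction.toPerm_apply, Units.smul_def, smul_eq_mul,
    mul_mul_mul_comm, Units.inv_mul, one_mul]
  rfl

theorem evalDFT_smul (b : F) (c : ZMod m → F) (j : ZMod m) :
    evalDFT ζ (fun i => b * c i) j = algebraMap F E b * evalDFT ζ c j := by
  simp [evalDFT, Finset.mul_sum, mul_assoc]

theorem evalDFT_sub (c d : ZMod m → F) (j : ZMod m) :
    evalDFT ζ (c - d) j = evalDFT ζ c j - evalDFT ζ d j := by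
  simp [evalDFT, sub_mul]

theorem evalDFT_cconv (hζ : ζ ^ m = 1) (c d : ZMod m → F) (j : ZMod m) :
    evalDFT ζ (cconv c d) j = evalDFT ζ c j * evalDFT ζ d j := by
  unfold evalDFT cconv
  rw [Finset.sum_mul_sum]
  simp only [map_sum, map_mul, Finset.sum_mul]
  rw [Finset.sum_comm]
  refine Finset.sum_congr rfl fun i' _ => Fintype.sum_equiv (Equiv.subRight i') _ _ fun i => ?_
  have : i * j = i' * j + (i - i') * j := by ring
  rw [Equiv.subRight_apply, this, pow_val_add hζ]
  ring

theorem evalDFT_pow_card [Fintype F] (hζ : ζ ^ m = 1) (c : ZMod m → F) (j : ZMod m) :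
    evalDFT ζ c j ^ Fintype.card F = evalDFT ζ c (Fintype.card F * j) := by
  change FiniteField.frobeniusAlgHom F E _ = _
  unfold evalDFT
  rw [map_sum]
  refine Finset.sum_congr rfl fun i _ => ?_
  rw [map_mul, AlgHom.commutes]
  change _ * (ζ ^ (i * j).val) ^ Fintype.card F = _
  rw [← pow_mul, pow_eq_pow_mod _ hζ, ← ZMod.val_natCast]
  congr 3
  push_cast
  rw [ZMod.natCast_zmod_val]
  ring

theorem evalDFT_pow_card_pow [Fintype F] (hζ : ζ ^ m = 1) (c : ZMod m → F) (j : ZMod m)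
    (r : ℕ) :
    evalDFT ζ c j ^ Fintype.card F ^ r = evalDFT ζ c (j * (Fintype.card F : ZMod m) ^ r) := by
  induction r with
  | zero => simp
  | succ r ih => rw [pow_succ, pow_mul, ih, evalDFT_pow_card hζ, pow_succ]; congr 1; ring

theorem evalDFT_injective (hζ : IsPrimitiveRoot ζ m) :
    Function.Injective (evalDFT ζ : (ZMod m → F) → ZMod m → E) := by
  intro c d hcd
  obtain ⟨m, rfl⟩ := Nat.exists_eq_succ_of_ne_zero (NeZero.ne m)
  have h0 (j : ZMod (m + 1)) : evalDFT ζ (c - d) j = 0 := by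
    rw [evalDFT_sub, hcd, sub_self]
  have hinj : Function.Injective fun j : Fin (m + 1) => ζ ^ (j : ℕ) :=
    fun i j hij => Fin.ext (hζ.pow_inj i.2 j.2 hij)
  have := Matrix.eq_zero_of_forall_index_sum_mul_pow_eq_zero hinj
    (v := fun i => algebraMap F E ((c - d) i)) fun j => by
      rw [← h0 j]
      refine Finset.sum_congr rfl fun i _ => ?_
      congr 1
      rw [← pow_mul, pow_eq_pow_mod _ hζ.pow_eq_one, mul_comm]
      rfl
  funext i
  exact sub_eq_zero.1 ((map_eq_zero (algebraMap F E)).1 (congrFun this i))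

theorem eq_of_evalDFT_eq [Fintype F] (hζ : IsPrimitiveRoot ζ m) {it : ℕ} {c d : ZMod m → F}
    (hc : inMinIdeal (Fintype.card F) ζ it c) (hd : inMinIdeal (Fintype.card F) ζ it d)
    (h : evalDFT ζ c it = evalDFT ζ d it) : c = d := by
  refine evalDFT_injective hζ (funext fun j => ?_)
  by_cases hj : j ∈ cycCoset (Fintype.card F) m it
  · obtain ⟨r, rfl⟩ := hj
    rw [← evalDFT_pow_card_pow hζ.pow_eq_one, h, evalDFT_pow_card_pow hζ.pow_eq_one]
  · rw [hc j hj, hd j hj]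

theorem units_pow_mul_eq_of_ncard_cycCoset {q it k : ℕ} (hq : q.Coprime m)
    (hk : (cycCoset q m it).ncard = k) :
    0 < k ∧ (it : ZMod m) * (q : ZMod m) ^ k = it := by
  classical
  set u := ZMod.unitOfCoprime q hq
  have hu : ((u : ZMod m)) = q := ZMod.coe_unitOfCoprime q hq
  have horbit : MulAction.orbit (Subgroup.zpowers u) (it : ZMod m) = cycCoset q m it := by
    ext j
    constructor
    · rintro ⟨⟨v, hv⟩, rfl⟩
      obtain ⟨r, rfl⟩ := ((isOfFinOrder_of_finite u).mem_powers_iff_mem_zpowers).2 hv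
      refine ⟨r, ?_⟩
      rw [← hu, mul_comm]
      simp [Subgroup.smul_def, Units.smul_def]
    · rintro ⟨r, rfl⟩
      refine ⟨⟨u ^ r, Subgroup.npow_mem_zpowers u r⟩, ?_⟩
      rw [← hu, mul_comm]
      simp [Subgroup.smul_def, Units.smul_def]
  have hper := MulAction.minimalPeriod_eq_card u (it : ZMod m)
  rw [← Nat.card_eq_fintype_card, Nat.card_coe_set_eq, horbit, hk] at hper
  refine ⟨?_, ?_⟩
  · rw [← hk, Set.ncard_pos]
    exact ⟨it, 0, by simp⟩
  · have := Function.iterate_minimalPeriod (f := fun x => u • x) (x := (it : ZMod m))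
    rw [hper, smul_iterate] at this
    rw [← hu, mul_comm]
    simpa [Units.smul_def] using this

end DFT

section Exponents

theorem IsPrimitiveRoot.pow_eq_pow_iff_natModEq {M : Type*} [CommMonoid M] {n : ℕ} [NeZero n]
    {θ : M} (hθ : IsPrimitiveRoot θ n) {s t : ℕ} : θ ^ s = θ ^ t ↔ s ≡ t [MOD n] := by
  rw [(hθ.isOfFinOrder (NeZero.ne n)).pow_eq_pow_iff_modEq, ← hθ.eq_orderOf]

theorem exists_units_algebraMap_eq {F E : Type*} [Field F] [Fintype F] [Field E] [Algebra F E]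
    {x : E} (hx : x ^ (Fintype.card F - 1) = 1) : ∃ b : Fˣ, algebraMap F E b = x := by
  classical
  obtain ⟨g, hg⟩ := IsCyclic.exists_generator (α := Fˣ)
  have hprim : IsPrimitiveRoot g (Fintype.card F - 1) := by
    rw [IsPrimitiveRoot.iff_orderOf, orderOf_eq_card_of_forall_mem_zpowers hg,
      Nat.card_eq_fintype_card, Fintype.card_units]
  have hE : IsPrimitiveRoot (algebraMap F E g) (Fintype.card F - 1) :=
    (IsPrimitiveRoot.coe_units_iff.2 hprim).map_of_injective (algebraMap F E).injective
  have : NeZero (Fintype.card F - 1) :=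
    ⟨Nat.sub_ne_zero_of_lt Fintype.one_lt_card⟩
  obtain ⟨i, -, hi⟩ := hE.eq_pow_of_pow_eq_one hx
  exact ⟨g ^ i, by simpa using hi⟩

theorem exists_gcd_natModEq (n a b : ℕ) [NeZero n] :
    ∃ x y : ℕ, Nat.gcd a b ≡ a * x + b * y [MOD n] := by
  refine ⟨(Nat.gcdA a b : ZMod n).val, (Nat.gcdB a b : ZMod n).val, ?_⟩
  rw [← ZMod.natCast_eq_natCast_iff]
  have := congrArg (Int.cast : ℤ → ZMod n) (Nat.gcd_eq_gcd_ab a b)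
  push_cast at this ⊢
  simpa using this

theorem gcd_mul_div_mul {n m it : ℕ} (h : m ∣ it * n) :
    Nat.gcd n (it * n / m) * m = n * Nat.gcd m it := by
  rw [← Nat.gcd_mul_right, Nat.div_mul_cancel h, mul_comm it n, Nat.gcd_mul_left]

variable {F E : Type*} [Field F] [Fintype F] [Field E] [Algebra F E] {m n it : ℕ} [NeZero m]
  {ζ θ : E}

theorem IsPrimitiveRoot.pow_div_gcd (hζ : IsPrimitiveRoot ζ m) (it : ℕ) :
    IsPrimitiveRoot (ζ ^ it) (m / m.gcd it) := by
  rw [IsPrimitiveRoot.iff_orderOf, (hζ.isOfFinOrder (NeZero.ne m)).orderOf_pow,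
    ← hζ.eq_orderOf]

theorem gcd_dvd_of_pow_eq (hζ : IsPrimitiveRoot ζ m) (hθ : IsPrimitiveRoot θ n)
    (hm : m ∣ it * n) {s : ℕ} (hs : θ ^ s = ζ ^ it) : Nat.gcd n (it * n / m) ∣ s := by
  have h1 : θ ^ (s * (m / m.gcd it)) = 1 := by
    rw [pow_mul, hs, (hζ.pow_div_gcd it).pow_eq_one]
  have h2 := Nat.mul_dvd_mul_right ((hθ.pow_eq_one_iff_dvd _).1 h1) (m.gcd it)
  rw [mul_assoc, Nat.div_mul_cancel (Nat.gcd_dvd_left _ _), ← gcd_mul_div_mul hm] at h2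
  exact Nat.dvd_of_mul_dvd_mul_right (NeZero.pos m) h2

theorem exists_pow_eq_pow_mul_div (hζ : IsPrimitiveRoot ζ m) (hθ : IsPrimitiveRoot θ n)
    (hm : m ∣ it * n) : ∃ r, (ζ ^ it) ^ r = θ ^ (it * n / m) := by
  have hd := hζ.pow_div_gcd it
  have hg := Nat.gcd_dvd_left m it
  have : NeZero (m / m.gcd it) :=
    ⟨(Nat.div_pos (Nat.le_of_dvd (NeZero.pos m) hg)
      (Nat.gcd_pos_of_pos_left _ (NeZero.pos m))).ne'⟩
  have hpow : (θ ^ (it * n / m)) ^ (m / m.gcd it) = 1 := by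
    rw [← pow_mul, hθ.pow_eq_one_iff_dvd]
    refine Nat.dvd_of_mul_dvd_mul_right (NeZero.pos m) ?_
    rw [mul_right_comm, Nat.div_mul_cancel hm, mul_right_comm, mul_comm n m]
    refine mul_dvd_mul_right ?_ n
    obtain ⟨t, ht⟩ := Nat.gcd_dvd_right m it
    refine ⟨t, ?_⟩
    conv_rhs => rw [← Nat.div_mul_cancel hg, mul_assoc, ← ht, mul_comm]
  obtain ⟨r, -, hr⟩ := hd.eq_pow_of_pow_eq_one hpow
  exact ⟨r, hr⟩

variable [NeZero n]

theorem exists_units_mul_pow_eq_pow_iff (hζ : IsPrimitiveRoot ζ m) (hθ : IsPrimitiveRoot θ n)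
    (hn : Fintype.card F - 1 ∣ n) (hm : m ∣ it * n) (s : ℕ) :
    (∃ (b : Fˣ) (r : ℕ), algebraMap F E b * (ζ ^ it) ^ r = θ ^ s) ↔
      Nat.gcd (n / (Fintype.card F - 1)) (it * n / m) ∣ s := by
  have hq : 0 < Fintype.card F - 1 := Nat.sub_pos_of_lt Fintype.one_lt_card
  have hdn : n / (Fintype.card F - 1) ∣ n := Nat.div_dvd_of_dvd hn
  constructor
  · rintro ⟨b, r, h⟩
    have hb : (algebraMap F E b) ^ (Fintype.card F - 1) = 1 := by
      rw [← map_pow, FiniteField.pow_card_sub_one_eq_one _ b.ne_zero, map_one]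
    have hbn : (algebraMap F E b) ^ n = 1 := by
      obtain ⟨t, ht⟩ := hn
      rw [ht, pow_mul, hb, one_pow]
    have hzn : (ζ ^ it) ^ n = 1 := by
      rw [← pow_mul, hζ.pow_eq_one_iff_dvd]
      exact hm
    obtain ⟨s₁, -, hs₁⟩ := hθ.eq_pow_of_pow_eq_one hbn
    obtain ⟨s₂, -, hs₂⟩ := hθ.eq_pow_of_pow_eq_one hzn
    rw [← hs₁, ← hs₂, ← pow_mul, ← pow_add, hθ.pow_eq_pow_iff_natModEq] at h
    rw [← (h.of_dvd ((Nat.gcd_dvd_left _ _).trans hdn)).dvd_iff dvd_rfl]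
    refine dvd_add ((Nat.gcd_dvd_left _ _).trans ?_) (Dvd.dvd.mul_right
      ((Nat.gcd_dvd_gcd_of_dvd_left _ hdn).trans (gcd_dvd_of_pow_eq hζ hθ hm hs₂)) r)
    rw [← hs₁, ← pow_mul, hθ.pow_eq_one_iff_dvd] at hb
    conv at hb => rw [← Nat.div_mul_cancel hn]
    exact Nat.dvd_of_mul_dvd_mul_right hq hb
  · rintro ⟨z, rfl⟩
    obtain ⟨b, hb⟩ := exists_units_algebraMap_eq (F := F)
      (x := θ ^ (n / (Fintype.card F - 1)))
      (by rw [← pow_mul, Nat.div_mul_cancel hn, hθ.pow_eq_one])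
    obtain ⟨r, hr⟩ := exists_pow_eq_pow_mul_div hζ hθ hm
    obtain ⟨x, y, hxy⟩ := exists_gcd_natModEq n (n / (Fintype.card F - 1)) (it * n / m)
    refine ⟨b ^ (x * z), r * (y * z), ?_⟩
    rw [Units.val_pow_eq_pow_val, map_pow, hb, pow_mul (ζ ^ it), hr, ← pow_mul, ← pow_mul,
      ← pow_add, hθ.pow_eq_pow_iff_natModEq]
    have := (hxy.mul_right z).symm
    rwa [add_mul, mul_assoc, mul_assoc] at this

theorem exists_add_mul_pow_modEq_iff {q k G : ℕ} (hq : 0 < q) (hn : n = q ^ k - 1) (hk : 0 < k)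
    (hG : G ∣ n) (x y : ℕ) :
    (∃ r s : ℕ, G ∣ s ∧ (s + x) * q ^ r ≡ y [MOD n]) ↔
      ∃ r : ℕ, (y : ZMod G) = (q : ZMod G) ^ r * x := by
  constructor
  · rintro ⟨r, s, hs, h⟩
    refine ⟨r, ?_⟩
    have h := (ZMod.natCast_eq_natCast_iff _ _ _).2 (h.of_dvd hG)
    have hs := (ZMod.natCast_eq_zero_iff _ _).2 hs
    push_cast at h
    rw [← h, hs]
    ring
  · rintro ⟨r, h⟩
    have hw : (q : ZMod n) ^ k = 1 := by
      have h1 : 1 ≤ q ^ k := Nat.one_le_pow _ _ hq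
      have h2 := (ZMod.natCast_eq_zero_iff (q ^ k - 1) n).2 (dvd_of_eq hn)
      rw [Nat.cast_sub h1] at h2
      push_cast at h2
      exact sub_eq_zero.1 h2
    have hinv : (q : ZMod n) ^ (r * (k - 1)) * (q : ZMod n) ^ r = 1 := by
      rw [← pow_add, ← Nat.mul_succ, Nat.succ_eq_add_one, Nat.sub_add_cancel hk, mul_comm r,
        pow_mul, hw, one_pow]
    have hinvG := congrArg (ZMod.castHom hG (ZMod G)) hinv
    simp only [map_mul, map_pow, map_natCast, map_one] at hinvG
    refine ⟨r, (y * (q : ZMod n) ^ (r * (k - 1)) - x : ZMod n).val, ?_, ?_⟩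
    · rw [← ZMod.natCast_eq_zero_iff, ← ZMod.cast_eq_val, ← ZMod.castHom_apply (h := hG)]
      simp only [map_sub, map_mul, map_pow, map_natCast]
      rw [h, sub_eq_zero]
      linear_combination (x : ZMod G) * hinvG
    · rw [← ZMod.natCast_eq_natCast_iff]
      push_cast
      rw [ZMod.natCast_zmod_val]
      linear_combination (y : ZMod n) * hinv

end Exponents

theorem finite_and_ncard_setOf_pow_eq_self_le {R : Type*} [CommRing R] [IsDomain R] {N : ℕ}
    (hN : 1 < N) : {x : R | x ^ N = x}.Finite ∧ {x : R | x ^ N = x}.ncard ≤ N := by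
  classical
  have hne : (Polynomial.X ^ N - Polynomial.X : Polynomial R) ≠ 0 := by
    intro h
    have := congrArg (Polynomial.coeff · N) h
    simp [Polynomial.coeff_X, hN.ne] at this
  have hset : {x : R | x ^ N = x} =
      ((Polynomial.X ^ N - Polynomial.X : Polynomial R).roots.toFinset : Set R) := by
    ext x
    simp [Polynomial.mem_roots hne, sub_eq_zero]
  rw [hset]
  refine ⟨Finset.finite_toSet _, ?_⟩
  rw [Set.ncard_coe_finset]
  refine (Multiset.toFinset_card_le _).trans ((Polynomial.card_roots' _).trans ?_)
  refine (Polynomial.natDegree_sub_le _ _).trans ?_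
  simp [hN.le]

section Code

variable {F E : Type*} [Field F] [Field E] [Algebra F E] {m l it : ℕ} [NeZero m]

/-- The value at `ζ ^ it` of the block of `c` at position `v₀`. -/
noncomputable def blockValue (ζ : E) (it : ℕ) (v₀ : Fin l) (c : ZMod m × Fin l → F) : E :=
  evalDFT ζ (fun i => c (i, v₀)) it

/-- Words whose blocks at the positions in `S` all equal the block at `v₀`, an element of the
minimal ideal, and whose other blocks vanish. -/
def repeatedIdealCode (F : Type*) {E : Type*} [Field F] [Fintype F] [Field E] [Algebra F E]
    {m l : ℕ} [NeZero m] (ζ : E) (it : ℕ) (S : Set (Fin l)) (v₀ : Fin l) :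
    Set (ZMod m × Fin l → F) :=
  {c | inMinIdeal (Fintype.card F) ζ it (fun i => c (i, v₀)) ∧
    ∀ i v, (v ∈ S → c (i, v) = c (i, v₀)) ∧ (v ∉ S → c (i, v) = 0)}

variable {ζ : E} {S : Set (Fin l)} {v₀ : Fin l} {c d : ZMod m × Fin l → F}

theorem blockValue_smul (b : F) :
    blockValue ζ it v₀ (b • c) = algebraMap F E b * blockValue ζ it v₀ c :=
  evalDFT_smul b (fun i => c (i, v₀)) it

theorem blockValue_shiftQC (hζ : ζ ^ m = 1) :
    blockValue ζ it v₀ (shiftQC F m l c) = ζ ^ it * blockValue ζ it v₀ c := by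
  refine (evalDFT_shift hζ (fun i => c (i, v₀)) it).trans ?_
  rw [ZMod.val_natCast, ← pow_eq_pow_mod _ hζ, blockValue]

theorem blockValue_shiftQC_pow (hζ : ζ ^ m = 1) (r : ℕ) :
    blockValue ζ it v₀ ((shiftQC F m l ^ r) c) = (ζ ^ it) ^ r * blockValue ζ it v₀ c := by
  induction r with
  | zero => simp
  | succ r ih => rw [pow_succ', LinearEquiv.mul_apply, blockValue_shiftQC hζ, ih]; ring

variable [Fintype F]

theorem smul_mem_repeatedIdealCode (b : F) (hc : c ∈ repeatedIdealCode F ζ it S v₀) :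
    b • c ∈ repeatedIdealCode F ζ it S v₀ := by
  refine ⟨fun j hj => ?_, fun i v => ⟨fun hv => ?_, fun hv => ?_⟩⟩
  · simpa [hc.1 j hj] using evalDFT_smul (ζ := ζ) b (fun i => c (i, v₀)) j
  · simp [(hc.2 i v).1 hv]
  · simp [(hc.2 i v).2 hv]

theorem shiftQC_mem_repeatedIdealCode (hζ : ζ ^ m = 1)
    (hc : c ∈ repeatedIdealCode F ζ it S v₀) :
    shiftQC F m l c ∈ repeatedIdealCode F ζ it S v₀ := by
  refine ⟨fun j hj => ?_, fun i v => hc.2 (i - 1) v⟩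
  exact (evalDFT_shift hζ (fun i => c (i, v₀)) j).trans (by rw [hc.1 j hj, mul_zero])

theorem shiftQC_pow_mem_repeatedIdealCode (hζ : ζ ^ m = 1)
    (hc : c ∈ repeatedIdealCode F ζ it S v₀) (r : ℕ) :
    (shiftQC F m l ^ r) c ∈ repeatedIdealCode F ζ it S v₀ := by
  induction r with
  | zero => exact hc
  | succ r ih => rw [pow_succ']; exact shiftQC_mem_repeatedIdealCode hζ ih

section Multiplier

variable {u : (ZMod m)ˣ}

theorem multiplierQC_mem_repeatedIdealCode (hu : (u : ZMod m) = Fintype.card F)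
    (hq : (Fintype.card F).Coprime m)
    (hc : c ∈ repeatedIdealCode F ζ it S v₀) :
    multiplierQC F m l u c ∈ repeatedIdealCode F ζ it S v₀ := by
  refine ⟨fun j hj => ?_, fun i v => hc.2 (u⁻¹ • i) v⟩
  refine (evalDFT_units_smul (fun i => c (i, v₀)) u j).trans (hc.1 _ fun h => hj ?_)
  exact mul_units_mem_cycCoset hq (hu ▸ h)

theorem multiplierQC_pow_mem_repeatedIdealCode (hu : (u : ZMod m) = Fintype.card F)
    (hq : (Fintype.card F).Coprime m)
    (hc : c ∈ repeatedIdealCode F ζ it S v₀) (r : ℕ) :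
    (multiplierQC F m l u ^ r) c ∈ repeatedIdealCode F ζ it S v₀ := by
  induction r with
  | zero => exact hc
  | succ r ih => rw [pow_succ']; exact multiplierQC_mem_repeatedIdealCode hu hq ih

theorem blockValue_multiplierQC (hu : (u : ZMod m) = Fintype.card F)
    (hζ : ζ ^ m = 1) :
    blockValue ζ it v₀ (multiplierQC F m l u c) =
      blockValue ζ it v₀ c ^ Fintype.card F := by
  refine (evalDFT_units_smul (fun i => c (i, v₀)) u it).trans ?_
  rw [hu, ← evalDFT_pow_card hζ, blockValue]

theorem blockValue_multiplierQC_pow (hu : (u : ZMod m) = Fintype.card F)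
    (hζ : ζ ^ m = 1) (r : ℕ) :
    blockValue ζ it v₀ ((multiplierQC F m l u ^ r) c) =
      blockValue ζ it v₀ c ^ Fintype.card F ^ r := by
  induction r with
  | zero => simp
  | succ r ih =>
    rw [pow_succ', LinearEquiv.mul_apply, blockValue_multiplierQC hu hζ, ih, ← pow_mul, pow_succ]

end Multiplier

theorem exists_zpow_orbit_iff_exists_pow (u : (ZMod m)ˣ) :
    (∃ (r₁ r₂ : ℤ) (b : Fˣ),
      (multiplierQC F m l u ^ r₁) ((shiftQC F m l ^ r₂) ((b : F) • c)) = d) ↔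
    ∃ (r₁ r₂ : ℕ) (b : Fˣ),
      (multiplierQC F m l u ^ r₁) ((shiftQC F m l ^ r₂) ((b : F) • c)) = d := by
  constructor
  · rintro ⟨r₁, r₂, b, rfl⟩
    have hfin (T : (ZMod m × Fin l → F) ≃ₗ[F] (ZMod m × Fin l → F)) (r : ℤ) :
        ∃ s : ℕ, T ^ s = T ^ r := by
      have : Finite ((ZMod m × Fin l → F) ≃ₗ[F] (ZMod m × Fin l → F)) := DFunLike.finite _
      exact (isOfFinOrder_of_finite T).mem_powers_iff_mem_zpowers.2 ⟨r, rfl⟩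
    obtain ⟨s₁, hs₁⟩ := hfin (multiplierQC F m l u) r₁
    obtain ⟨s₂, hs₂⟩ := hfin (shiftQC F m l) r₂
    exact ⟨s₁, s₂, b, by rw [hs₁, hs₂]⟩
  · rintro ⟨r₁, r₂, b, h⟩
    exact ⟨r₁, r₂, b, by simpa only [zpow_natCast] using h⟩

theorem blockValue_injOn (hζ : IsPrimitiveRoot ζ m) :
    Set.InjOn (blockValue ζ it v₀ : (ZMod m × Fin l → F) → E) (repeatedIdealCode F ζ it S v₀) := by
  intro c hc d hd h
  have hblock := eq_of_evalDFT_eq hζ hc.1 hd.1 h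
  funext ⟨i, v⟩
  by_cases hv : v ∈ S
  · rw [(hc.2 i v).1 hv, (hd.2 i v).1 hv]
    exact congrFun hblock i
  · rw [(hc.2 i v).2 hv, (hd.2 i v).2 hv]

theorem blockValue_pow_card_pow (hζ : ζ ^ m = 1) {k : ℕ}
    (hk : (it : ZMod m) * (Fintype.card F : ZMod m) ^ k = it) :
    blockValue ζ it v₀ c ^ Fintype.card F ^ k = blockValue ζ it v₀ c := by
  rw [blockValue, evalDFT_pow_card_pow hζ, hk]

end Code

theorem hammingNorm_multiplierQC_shiftQC_smul {F : Type*} [Field F] [DecidableEq F] {m l : ℕ}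
    [NeZero m] (u : (ZMod m)ˣ) (r₁ r₂ : ℕ) (b : Fˣ) (c : ZMod m × Fin l → F) :
    hammingNorm ((multiplierQC F m l u ^ r₁) ((shiftQC F m l ^ r₂) ((b : F) • c))) =
      hammingNorm c := by
  have hperm (σ : Equiv.Perm (ZMod m × Fin l)) (r : ℕ) (x : ZMod m × Fin l → F) :
      hammingNorm (((LinearEquiv.funCongrLeft F F σ) ^ r) x) = hammingNorm x := by
    induction r with
    | zero => rfl
    | succ r ih =>
      rw [pow_succ', LinearEquiv.mul_apply, ← ih]
      exact Finset.card_equiv σ fun i => by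
        simp only [Finset.mem_filter, Finset.mem_univ, true_and]
        rfl
  rw [multiplierQC, shiftQC, hperm, hperm]
  exact hammingNorm_smul (fun _ => IsUnit.isSMulRegular F b.isUnit) c

section Orbits

theorem exists_isPrimitiveRoot_of_ncard {R : Type*} [Field R] {N : ℕ} (hN : 1 < N)
    (h : {x : R | x ^ N = x}.ncard = N) : ∃ θ : R, IsPrimitiveRoot θ (N - 1) := by
  have : NeZero (N - 1) := ⟨Nat.sub_ne_zero_of_lt hN⟩
  refine card_rootsOfUnity_eq_iff_exists_isPrimitiveRoot.1 ?_
  have himage : ((↑) : Rˣ → R) '' (rootsOfUnity (N - 1) R : Set Rˣ) =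
      {x : R | x ^ N = x} \ {0} := by
    ext x
    constructor
    · rintro ⟨w, hw, rfl⟩
      refine ⟨?_, w.ne_zero⟩
      have := congrArg (Units.val : Rˣ → R) ((mem_rootsOfUnity _ _).1 hw)
      rw [Units.val_pow_eq_pow_val, Units.val_one] at this
      change (w : R) ^ N = w
      rw [← Nat.sub_add_cancel hN.le, pow_succ, this, one_mul]
    · rintro ⟨hx, h0⟩
      change x ^ N = x at hx
      rw [← Nat.sub_add_cancel hN.le, pow_succ] at hx
      refine ⟨Units.mk0 x h0, (mem_rootsOfUnity _ _).2 (Units.ext ?_), rfl⟩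
      exact mul_right_cancel₀ h0 (hx.trans (one_mul x).symm)
  have hcard := Set.ncard_image_of_injective (rootsOfUnity (N - 1) R : Set Rˣ)
    (Units.val_injective (α := R))
  rw [himage, Set.ncard_sdiff_singleton_of_mem (by simp [show N ≠ 0 by omega]), h] at hcard
  exact hcard.symm

variable {F E : Type*} [Field F] [Fintype F] [Field E] [Algebra F E] {m l k it : ℕ} [NeZero m]
  {ζ : E}

theorem exists_eq_repeatedIdealCode (hζ : IsPrimitiveRoot ζ m) (hk0 : 0 < k)
    (hk : (it : ZMod m) * (Fintype.card F : ZMod m) ^ k = it)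
    {f : ZMod m → F} (hf : inMinIdeal (Fintype.card F) ζ it f)
    {a : Fin l → ZMod m → F} (ha : ∀ v : Fin l, a v = 0 ∨ a v = f)
    {C : Set ((ZMod m × Fin l) → F)}
    (hC : C = {c | ∃ g : ZMod m → F, inMinIdeal (Fintype.card F) ζ it g ∧
      ∀ (i : ZMod m) (v : Fin l), c (i, v) = cconv g (a v) i})
    (hdim : C.ncard = Fintype.card F ^ k) :
    ∃ (S : Set (Fin l)) (v₀ : Fin l), C = repeatedIdealCode F ζ it S v₀ ∧
      Set.BijOn (blockValue ζ it v₀) C {x : E | x ^ Fintype.card F ^ k = x} := by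
  have hN : 1 < Fintype.card F ^ k := Nat.one_lt_pow hk0.ne' Fintype.one_lt_card
  have hconv0 (g : ZMod m → F) : cconv g 0 = 0 := by
    funext i
    simp [cconv]
  obtain ⟨v₀, hv₀⟩ : ∃ v₀, a v₀ ≠ 0 := by
    by_contra! h
    have hsub : C ⊆ {0} := by
      rw [hC]
      rintro c ⟨g, -, hc⟩
      funext ⟨i, v⟩
      rw [hc, h, hconv0]
      rfl
    have := Set.ncard_le_ncard hsub
    rw [Set.ncard_singleton] at this
    omega
  have hav₀ : a v₀ = f := (ha v₀).resolve_left hv₀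
  have hsub : C ⊆ repeatedIdealCode F ζ it {v | a v = f} v₀ := by
    rw [hC]
    rintro c ⟨g, -, hc⟩
    refine ⟨fun j hj => ?_, fun i v => ⟨fun hv => ?_, fun hv => ?_⟩⟩
    · simp only [hc, hav₀]
      exact (evalDFT_cconv hζ.pow_eq_one g f j).trans (by rw [hf j hj, mul_zero])
    · rw [hc, hc, hav₀, show a v = f from hv]
    · rw [hc, (ha v).resolve_right hv, hconv0]
      rfl
  obtain ⟨hfin, hcard⟩ := finite_and_ncard_setOf_pow_eq_self_le (R := E) hN
  have hmaps : Set.MapsTo (blockValue ζ it v₀ : (ZMod m × Fin l → F) → E)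
      (repeatedIdealCode F ζ it {v | a v = f} v₀)
      {x : E | x ^ Fintype.card F ^ k = x} :=
    fun c _ => blockValue_pow_card_pow hζ.pow_eq_one hk
  have hinj := blockValue_injOn (it := it) (S := {v | a v = f}) (v₀ := v₀) (F := F) hζ
  have hle := (Set.ncard_le_ncard_of_injOn _ hmaps hinj hfin).trans hcard
  have hCeq := Set.eq_of_subset_of_ncard_le hsub (hle.trans hdim.ge)
  refine ⟨_, v₀, hCeq, ?_⟩
  rw [hCeq] at hdim ⊢
  refine ⟨hmaps, hinj, ?_⟩
  rw [Set.SurjOn, Set.eq_of_subset_of_ncard_le hmaps.image_subset ?_ hfin]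
  rw [hinj.ncard_image, hdim]
  exact hcard

theorem exists_orbit_iff_exists_pow_mul (hζ : ζ ^ m = 1)
    (hq : (Fintype.card F).Coprime m) {u : (ZMod m)ˣ} (hu : (u : ZMod m) = Fintype.card F)
    {S : Set (Fin l)} {v₀ : Fin l} {c d : ZMod m × Fin l → F}
    (hinj : Set.InjOn (blockValue ζ it v₀ : (ZMod m × Fin l → F) → E) (repeatedIdealCode F ζ it S v₀))
    (hc : c ∈ repeatedIdealCode F ζ it S v₀) (hd : d ∈ repeatedIdealCode F ζ it S v₀) :
    (∃ (r₁ r₂ : ℤ) (b : Fˣ),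
      (multiplierQC F m l u ^ r₁) ((shiftQC F m l ^ r₂) ((b : F) • c)) = d) ↔
    ∃ (r₁ r₂ : ℕ) (b : Fˣ),
      (algebraMap F E b * (ζ ^ it) ^ r₂ * blockValue ζ it v₀ c) ^ Fintype.card F ^ r₁ =
        blockValue ζ it v₀ d := by
  rw [exists_zpow_orbit_iff_exists_pow]
  refine exists_congr fun r₁ => exists_congr fun r₂ => exists_congr fun b => ?_
  rw [← hinj.eq_iff (multiplierQC_pow_mem_repeatedIdealCode hu hq
      (shiftQC_pow_mem_repeatedIdealCode hζ (smul_mem_repeatedIdealCode (b : F) hc) r₂) r₁) hd,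
    blockValue_multiplierQC_pow hu hζ, blockValue_shiftQC_pow hζ, blockValue_smul,
    mul_left_comm, mul_assoc]

theorem mem_of_exists_orbit (hζ : ζ ^ m = 1)
    (hq : (Fintype.card F).Coprime m) {u : (ZMod m)ˣ} (hu : (u : ZMod m) = Fintype.card F)
    {S : Set (Fin l)} {v₀ : Fin l} {c d : ZMod m × Fin l → F}
    (hc : c ∈ repeatedIdealCode F ζ it S v₀) (hc0 : c ≠ 0)
    (h : ∃ (r₁ r₂ : ℤ) (b : Fˣ),
      (multiplierQC F m l u ^ r₁) ((shiftQC F m l ^ r₂) ((b : F) • c)) = d) :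
    d ∈ repeatedIdealCode F ζ it S v₀ ∧ d ≠ 0 := by
  obtain ⟨r₁, r₂, b, rfl⟩ := (exists_zpow_orbit_iff_exists_pow u).1 h
  refine ⟨multiplierQC_pow_mem_repeatedIdealCode hu hq
      (shiftQC_pow_mem_repeatedIdealCode hζ (smul_mem_repeatedIdealCode (b : F) hc) r₂) r₁, ?_⟩
  simp [hc0]

end Orbits

/-- Let `C` be a one-generator quasi-cyclic code which is the `[l, 1]`
linear code over `R_m ε_t` generated by `(a_0(x), …, a_{l-1}(x))` with each `a_v ∈ {0, f}`.
Then the number `N` of orbits of `⟨μ_q, ρ^l, M⟩` on `C \ {0}` equals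
`(1/k) Σ_{r ∣ k} φ(k/r) gcd(q^r - 1, (q^k - 1)/(q - 1), i_t (q^k - 1)/m)`; in particular
`s(C) ≤ N`, with equality iff any two nonzero codewords of the same weight lie in the same
`⟨μ_q, ρ^l, M⟩`-orbit. -/
theorem orbits_one_generator_minimal_ideal {F E : Type*} [Field F] [Fintype F] [DecidableEq F]
    [Field E] [Algebra F E] {m l k it : ℕ} [NeZero m] (hl : 2 ≤ l)
    (hco : Nat.Coprime m (Fintype.card F))
    (u : (ZMod m)ˣ) (hu : u = ZMod.unitOfCoprime (Fintype.card F) hco.symm)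
    (ζ : E) (hζ : IsPrimitiveRoot ζ m)
    (f : ZMod m → F) (hf : inMinIdeal (Fintype.card F) ζ it f)
    (a : Fin l → ZMod m → F) (ha : ∀ v : Fin l, a v = 0 ∨ a v = f)
    (C : Set ((ZMod m × Fin l) → F))
    (hC : C = {c | ∃ g : ZMod m → F, inMinIdeal (Fintype.card F) ζ it g ∧
      ∀ (i : ZMod m) (v : Fin l), c (i, v) = cconv g (a v) i})
    (hk : (cycCoset (Fintype.card F) m it).ncard = k)
    (hdim : C.ncard = Fintype.card F ^ k)
    (N : ℕ)
    (hN : Set.ncard {O : Set ((ZMod m × Fin l) → F) | ∃ c, c ∈ C ∧ c ≠ 0 ∧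
      O = {x | ∃ (r₁ r₂ : ℤ) (b : Fˣ),
        (multiplierQC F m l u ^ r₁) ((shiftQC F m l ^ r₂) ((b : F) • c)) = x}} = N) :
    (N : ℚ) = (∑ r ∈ k.divisors, Nat.totient (k / r) *
        Nat.gcd (Fintype.card F ^ r - 1)
          (Nat.gcd ((Fintype.card F ^ k - 1) / (Fintype.card F - 1))
            (it * (Fintype.card F ^ k - 1) / m)) : ℕ) / (k : ℚ) ∧
    Set.ncard {w : ℕ | ∃ c, c ∈ C ∧ c ≠ 0 ∧ hammingNorm c = w} ≤ N ∧
    (Set.ncard {w : ℕ | ∃ c, c ∈ C ∧ c ≠ 0 ∧ hammingNorm c = w} = N ↔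
      ∀ c₁ c₂ : (ZMod m × Fin l) → F, c₁ ∈ C → c₂ ∈ C → c₁ ≠ 0 → c₂ ≠ 0 →
        hammingNorm c₁ = hammingNorm c₂ →
          ∃ (r₁ r₂ : ℤ) (b : Fˣ),
            (multiplierQC F m l u ^ r₁) ((shiftQC F m l ^ r₂) ((b : F) • c₁)) = c₂) := by
  classical
  have hq2 : 1 < Fintype.card F := Fintype.one_lt_card
  have hu' : (u : ZMod m) = Fintype.card F := by rw [hu, ZMod.coe_unitOfCoprime]
  obtain ⟨hk0, hkit⟩ := units_pow_mul_eq_of_ncard_cycCoset hco.symm hk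
  have hq1 : 1 < Fintype.card F ^ k := Nat.one_lt_pow hk0.ne' hq2
  obtain ⟨S, v₀, hCS, hbij⟩ := exists_eq_repeatedIdealCode hζ hk0 hkit hf ha hC hdim
  obtain ⟨θ, hθ⟩ := exists_isPrimitiveRoot_of_ncard (R := E) hq1
    (by rw [← hbij.image_eq, hbij.injOn.ncard_image, hdim])
  obtain ⟨n, hn⟩ : ∃ n, n = Fintype.card F ^ k - 1 := ⟨_, rfl⟩
  rw [← hn] at hθ ⊢
  have : NeZero n := ⟨by omega⟩
  have : NeZero k := ⟨hk0.ne'⟩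
  have hqn : Fintype.card F - 1 ∣ n := hn ▸ Nat.sub_one_dvd_pow_sub_one _ _
  have hmn : m ∣ it * n := by
    rw [← ZMod.natCast_eq_zero_iff, hn, Nat.cast_mul, Nat.cast_sub hq1.le, mul_sub]
    push_cast
    rw [hkit, mul_one, sub_self]
  obtain ⟨G, hGdef⟩ : ∃ G, G = Nat.gcd (n / (Fintype.card F - 1)) (it * n / m) := ⟨_, rfl⟩
  rw [← hGdef]
  have hGn : G ∣ n := hGdef ▸ (Nat.gcd_dvd_left _ _).trans (Nat.div_dvd_of_dvd hqn)
  have : NeZero G := ⟨fun h => NeZero.ne n (Nat.eq_zero_of_zero_dvd (h ▸ hGn))⟩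
  have hzero : (0 : ZMod m × Fin l → F) ∈ C := by
    rw [hC]
    exact ⟨0, fun j _ => by simp [evalDFT], fun i v => by simp [cconv]⟩
  have hvalue0 : blockValue ζ it v₀ (0 : ZMod m × Fin l → F) = 0 := by
    simp [blockValue, evalDFT]
  have hvalue (x : ZMod m × Fin l → F) (hx : x ∈ C \ {0}) :
      ∃ s : ℕ, θ ^ s = blockValue ζ it v₀ x := by
    have hne : blockValue ζ it v₀ x ≠ 0 := fun h =>
      hx.2 (hbij.injOn hx.1 hzero (h.trans hvalue0.symm))
    have hpow : blockValue ζ it v₀ x ^ Fintype.card F ^ k = blockValue ζ it v₀ x :=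
      hbij.mapsTo hx.1
    rw [← Nat.sub_add_cancel hq1.le, ← hn, pow_succ] at hpow
    obtain ⟨s, -, hs⟩ := hθ.eq_pow_of_pow_eq_one
      (mul_right_cancel₀ hne (hpow.trans (one_mul _).symm))
    exact ⟨s, hs⟩
  choose! e he using hvalue
  obtain ⟨Q, _, p, hpsurj, hp, hcard⟩ :=
    exists_quotient_zmod_mul_pow (k := k) (G := G) (Nat.zero_lt_of_lt hq2) (hn ▸ hGn)
  let rel (c x : ZMod m × Fin l → F) : Prop := ∃ (r₁ r₂ : ℤ) (b : Fˣ),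
    (multiplierQC F m l u ^ r₁) ((shiftQC F m l ^ r₂) ((b : F) • c)) = x
  have hrel : ∀ x ∈ C \ {0}, ∀ y ∈ C \ {0}, rel x y ↔ p (e x) = p (e y) := by
    intro x hx y hy
    rw [hp, ← exists_add_mul_pow_modEq_iff (Nat.zero_lt_of_lt hq2) hn hk0 hGn]
    refine (exists_orbit_iff_exists_pow_mul hζ.pow_eq_one hco.symm hu' (hCS ▸ hbij.injOn)
      (hCS ▸ hx.1) (hCS ▸ hy.1)).trans (exists_congr fun r₁ => ?_)
    simp only [← he x hx, ← he y hy, ← hθ.pow_eq_pow_iff_natModEq, hGdef,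
      ← exists_units_mul_pow_eq_pow_iff hζ hθ hqn hmn]
    constructor
    · rintro ⟨r₂, b, h⟩
      have hbn : (algebraMap F E b * (ζ ^ it) ^ r₂) ^ n = 1 := by
        obtain ⟨t, ht⟩ := hqn
        rw [mul_pow, ← pow_mul, ← pow_mul, mul_comm r₂, ← mul_assoc it, pow_mul,
          (hζ.pow_eq_one_iff_dvd _).2 hmn, one_pow, mul_one, ← map_pow, ht, pow_mul,
          FiniteField.pow_card_sub_one_eq_one _ b.ne_zero, one_pow, map_one]
      obtain ⟨s, -, hs⟩ := hθ.eq_pow_of_pow_eq_one hbn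
      exact ⟨s, ⟨b, r₂, hs.symm⟩, by rw [pow_mul, pow_add, hs, h]⟩
    · rintro ⟨s, ⟨b, r₂, hs⟩, h⟩
      exact ⟨r₂, b, by rw [hs, ← pow_add, ← pow_mul, h]⟩
  have hmem : ∀ x ∈ C \ {0}, ∀ y, rel x y → y ∈ C \ {0} := fun x hx y hxy =>
    hCS ▸ mem_of_exists_orbit hζ.pow_eq_one hco.symm hu' (hCS ▸ hx.1) hx.2 hxy
  have horbit : ∀ x ∈ C \ {0}, ∀ y ∈ C \ {0},
      {z | rel x z} = {z | rel y z} ↔ p (e x) = p (e y) := by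
    intro x hx y hy
    constructor
    · intro h
      have hy' : y ∈ {z | rel x z} := h ▸ (hrel y hy y hy).2 rfl
      exact (hrel x hx y hy).1 hy'
    · intro h
      ext z
      constructor
      · intro hz
        have hzC := hmem x hx z hz
        exact (hrel y hy z hzC).2 (h.symm.trans ((hrel x hx z hzC).1 hz))
      · intro hz
        have hzC := hmem y hy z hz
        exact (hrel x hx z hzC).2 (h.trans ((hrel y hy z hzC).1 hz))
  have hfin : (C \ {0}).Finite := Set.toFinite _
  have hclasses : {O | ∃ c, c ∈ C ∧ c ≠ 0 ∧ O = {x | rel c x}} =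
      (fun c => {x | rel c x}) '' (C \ {0}) := by
    ext O
    exact ⟨fun ⟨c, hc, hc0, h⟩ => ⟨c, ⟨hc, hc0⟩, h.symm⟩,
      fun ⟨c, ⟨hc, hc0⟩, h⟩ => ⟨c, hc, hc0, h.symm⟩⟩
  have hweights : {w : ℕ | ∃ c, c ∈ C ∧ c ≠ 0 ∧ hammingNorm c = w} =
      hammingNorm '' (C \ {0}) := by
    ext w
    exact ⟨fun ⟨c, hc, hc0, h⟩ => ⟨c, ⟨hc, hc0⟩, h⟩, fun ⟨c, ⟨hc, hc0⟩, h⟩ => ⟨c, hc, hc0, h⟩⟩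
  have hcover : (fun c => p (e c)) '' (C \ {0}) = Set.univ := by
    refine Set.eq_univ_of_forall fun t => ?_
    obtain ⟨x, rfl⟩ := hpsurj t
    have hpow : (θ ^ x.val) ^ Fintype.card F ^ k = θ ^ x.val := by
      rw [← Nat.sub_add_cancel hq1.le, ← hn, pow_succ, pow_right_comm, hθ.pow_eq_one, one_pow,
        one_mul]
    obtain ⟨c, hc, hcx⟩ := hbij.surjOn hpow
    have hc0 : c ∈ C \ {0} := by
      refine ⟨hc, fun h => ?_⟩
      rw [Set.mem_singleton_iff.1 h, hvalue0] at hcx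
      exact pow_ne_zero _ (hθ.ne_zero (NeZero.ne n)) hcx.symm
    refine ⟨c, hc0, congrArg p ?_⟩
    rw [← he c hc0, hθ.pow_eq_pow_iff_natModEq] at hcx
    simpa using (ZMod.natCast_eq_natCast_iff _ _ _).2 (hcx.of_dvd hGn)
  have : Nonempty Q := ⟨p 0⟩
  have hNQ : N = Fintype.card Q := by
    rw [← hN, ← Nat.card_eq_fintype_card, ← Set.ncard_univ, ← hcover]
    refine (congrArg Set.ncard hclasses).trans (Eq.symm ?_)
    exact (ncard_image_eq_ncard_image_iff hfin fun x hx y hy => (horbit x hx y hy).1).2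
      fun x hx y hy => (horbit x hx y hy).2
  have hNrel : N = ((fun c => {x | rel c x}) '' (C \ {0})).ncard :=
    hN.symm.trans (congrArg Set.ncard hclasses)
  have hwt : ∀ x ∈ C \ {0}, ∀ y ∈ C \ {0},
      {z | rel x z} = {z | rel y z} → hammingNorm x = hammingNorm y := by
    intro x hx y hy h
    obtain ⟨r₁, r₂, b, rfl⟩ := (exists_zpow_orbit_iff_exists_pow u).1
      ((hrel x hx y hy).2 ((horbit x hx y hy).1 h))
    exact (hammingNorm_multiplierQC_shiftQC_smul u r₁ r₂ b x).symm
  refine ⟨?_, ?_, ?_⟩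
  · rw [eq_div_iff (Nat.cast_ne_zero.2 hk0.ne'), ← hcard, hNQ, Nat.cast_mul]
  · rw [hweights, hNrel]
    exact ncard_image_le_ncard_image hfin hwt
  · rw [hweights, hNrel, ncard_image_eq_ncard_image_iff hfin hwt]
    constructor
    · intro h c₁ c₂ h₁ h₂ h₁0 h₂0 hw
      have hc₁ : c₁ ∈ C \ {0} := ⟨h₁, h₁0⟩
      have hc₂ : c₂ ∈ C \ {0} := ⟨h₂, h₂0⟩
      exact (hrel c₁ hc₁ c₂ hc₂).2 ((horbit c₁ hc₁ c₂ hc₂).1 (h c₁ hc₁ c₂ hc₂ hw))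
    · intro h x hx y hy hw
      exact (horbit x hx y hy).2 ((hrel x hx y hy).1 (h x y hx.1 hy.1 hx.2 hy.2 hw))
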